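/- arXiv:1905.01970 — 2 statements merged into one kernel-verified Lean document; each statement's English description precedes it below -/
import Mathlib

section
/- Let ρ₋, ρ₊ > 0 and u₋ > u₊. Suppose ρ* : (1,2) → ℝ is a continuous function such that for every γ ∈ (1,2), ρ*(γ) > max(ρ₋,ρ₊) and u₋ − u₊ = Θ_γ(ρ*(γ),ρ₋)·(ρ*(γ) − ρ₋) + Θ_γ(ρ*(γ),ρ₊)·(ρ*(γ) − ρ₊). Then ((γ−1)/2)·ρ*(γ)^{γ−1} → (u₋ − u₊)²/4 as γ → 1⁺. -/
open Real Filter Topology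

/-- The shock-curve slope coefficient Θ_γ(a,b) from equation (4.9). -/
noncomputable def Theta (γ a b : ℝ) : ℝ :=
  Real.sqrt (((γ - 1) / 2) * (a ^ (γ - 1) - b ^ (γ - 1)) / ((a + b) * (a - b)))

lemma Theta_mul_sub {γ a b : ℝ} (hb : 0 < b) (hab : b < a) :
    Theta γ a b * (a - b) =
      √(((γ - 1) / 2 * a ^ (γ - 1) - (γ - 1) / 2 * b ^ (γ - 1)) * ((a - b) / (a + b))) := by
  have h : 0 < a - b := sub_pos.2 hab
  have hs : 0 < a + b := by linarith
  rw [Theta]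
  nth_rewrite 2 [← Real.sqrt_sq h.le]
  rw [← Real.sqrt_mul' _ (sq_nonneg _)]
  congr 1
  field_simp

lemma Theta_mul_sub_le {γ a b : ℝ} (hγ : 1 < γ) (hb : 0 < b) (hab : b < a) :
    Theta γ a b * (a - b) ≤ √((γ - 1) / 2 * a ^ (γ - 1)) := by
  rw [Theta_mul_sub hb hab]
  apply Real.sqrt_le_sqrt
  have hε : 0 < (γ - 1) / 2 := by linarith
  have hpos : 0 < b ^ (γ - 1) := Real.rpow_pos_of_pos hb _
  have hmono : b ^ (γ - 1) ≤ a ^ (γ - 1) :=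
    Real.rpow_le_rpow hb.le hab.le (by linarith)
  have hq : (a - b) / (a + b) ≤ 1 := (div_le_one (by linarith)).2 (by linarith)
  calc _ ≤ ((γ - 1) / 2 * a ^ (γ - 1) - (γ - 1) / 2 * b ^ (γ - 1)) * 1 := by
        apply mul_le_mul_of_nonneg_left hq
        nlinarith
    _ ≤ _ := by nlinarith

lemma le_Theta_mul_sub {γ a b c : ℝ} (hγ : 1 < γ) (hb : 0 < b) (hbc : b ≤ c) (hca : c < a) :
    √(((γ - 1) / 2 * a ^ (γ - 1) - (γ - 1) / 2 * c ^ (γ - 1)) * ((a - c) / (a + c))) ≤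
      Theta γ a b * (a - b) := by
  rw [Theta_mul_sub hb (hbc.trans_lt hca)]
  apply Real.sqrt_le_sqrt
  have hε : 0 < (γ - 1) / 2 := by linarith
  have hbc' : b ^ (γ - 1) ≤ c ^ (γ - 1) := Real.rpow_le_rpow hb.le hbc (by linarith)
  have hca' : c ^ (γ - 1) ≤ a ^ (γ - 1) :=
    Real.rpow_le_rpow (hb.le.trans hbc) hca.le (by linarith)
  apply mul_le_mul
  · nlinarith
  · apply div_le_div₀ <;> linarith
  · exact div_nonneg (by linarith) (by linarith)
  · nlinarith

lemma tendsto_sub_one_div_two_mul_rpow {c : ℝ} (hc : 0 < c) :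
    Tendsto (fun γ : ℝ => (γ - 1) / 2 * c ^ (γ - 1)) (𝓝[>] (1 : ℝ)) (𝓝 0) := by
  have h : ContinuousAt (fun γ : ℝ => (γ - 1) / 2 * c ^ (γ - 1)) 1 := by
    refine ContinuousAt.mul (by fun_prop) ?_
    exact ContinuousAt.rpow continuousAt_const (by fun_prop) (Or.inl hc.ne')
  have h' := h.tendsto.mono_left (nhdsWithin_le_nhds (s := Set.Ioi (1 : ℝ)))
  simpa using h'

/-- Lemma 4.2, second assertion: ((γ−1)/2)·ρ*(γ)^{γ−1} → (u₋−u₊)²/4 as γ → 1⁺. -/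
theorem lemma42_limit (ρm ρp um up : ℝ) (hρm : 0 < ρm) (hρp : 0 < ρp)
    (hu : up < um) (ρs : ℝ → ℝ) (hcont : ContinuousOn ρs (Set.Ioo (1 : ℝ) 2))
    (hgt : ∀ γ ∈ Set.Ioo (1 : ℝ) 2, ρs γ > max ρm ρp)
    (heq : ∀ γ ∈ Set.Ioo (1 : ℝ) 2,
      um - up = Theta γ (ρs γ) ρm * (ρs γ - ρm) + Theta γ (ρs γ) ρp * (ρs γ - ρp)) :
    Tendsto (fun γ : ℝ => ((γ - 1) / 2) * (ρs γ) ^ (γ - 1))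
      (𝓝[>] (1 : ℝ)) (𝓝 ((um - up) ^ 2 / 4)) := by
  have hD : 0 < um - up := sub_pos.2 hu
  set c := max ρm ρp with hc_def
  have hc : 0 < c := lt_max_of_lt_left hρm
  have hmem : ∀ᶠ γ in 𝓝[>] (1 : ℝ), γ ∈ Set.Ioo (1 : ℝ) 2 :=
    Ioo_mem_nhdsGT (by norm_num)
  have hlower : ∀ γ ∈ Set.Ioo (1 : ℝ) 2,
      (um - up) ^ 2 / 4 ≤ (γ - 1) / 2 * (ρs γ) ^ (γ - 1) := by
    intro γ hγ
    have hr := hgt γ hγ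
    have h1 := Theta_mul_sub_le hγ.1 hρm ((le_max_left ρm ρp).trans_lt hr)
    have h2 := Theta_mul_sub_le hγ.1 hρp ((le_max_right ρm ρp).trans_lt hr)
    have h3 : (um - up) / 2 ≤ √((γ - 1) / 2 * (ρs γ) ^ (γ - 1)) := by
      linarith [heq γ hγ]
    have h4 := (Real.le_sqrt' (by linarith)).1 h3
    linarith
  have hupper : ∀ γ ∈ Set.Ioo (1 : ℝ) 2, (γ - 1) / 2 * (ρs γ) ^ (γ - 1) ≤
      (um - up) ^ 2 / 4 / ((ρs γ - c) / (ρs γ + c)) + (γ - 1) / 2 * c ^ (γ - 1) := by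
    intro γ hγ
    have hr : c < ρs γ := hgt γ hγ
    have h1 := le_Theta_mul_sub hγ.1 hρm (le_max_left ρm ρp) hr
    have h2 := le_Theta_mul_sub hγ.1 hρp (le_max_right ρm ρp) hr
    rw [← hc_def] at h1 h2
    have h3 := (Real.sqrt_le_left (by linarith : 0 ≤ (um - up) / 2)).1
      ((by linarith [heq γ hγ]) : √(((γ - 1) / 2 * ρs γ ^ (γ - 1) - (γ - 1) / 2 * c ^ (γ - 1)) *
        ((ρs γ - c) / (ρs γ + c))) ≤ (um - up) / 2)
    have hq : 0 < (ρs γ - c) / (ρs γ + c) := div_pos (by linarith) (by linarith)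
    rw [← sub_le_iff_le_add, le_div_iff₀ hq]
    linarith
  have hatTop : Tendsto ρs (𝓝[>] (1 : ℝ)) atTop := by
    refine tendsto_atTop.2 fun K => ?_
    have hK := (tendsto_sub_one_div_two_mul_rpow (lt_max_of_lt_left hc : 0 < max c K)).eventually
      (gt_mem_nhds (by positivity : 0 < (um - up) ^ 2 / 4))
    filter_upwards [hmem, hK] with γ hγ hγK
    by_contra! hlt
    have hr : c < ρs γ := hgt γ hγ
    have hmono : (ρs γ) ^ (γ - 1) ≤ (max c K) ^ (γ - 1) :=
      Real.rpow_le_rpow (hc.trans hr).le (hlt.le.trans (le_max_right _ _)) (by linarith [hγ.1])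
    have := mul_le_mul_of_nonneg_left hmono (by linarith [hγ.1] : 0 ≤ (γ - 1) / 2)
    linarith [hlower γ hγ]
  have hq : Tendsto (fun γ => (ρs γ - c) / (ρs γ + c)) (𝓝[>] (1 : ℝ)) (𝓝 1) := by
    have h : Tendsto (fun γ => 1 - 2 * c / (ρs γ + c)) (𝓝[>] (1 : ℝ)) (𝓝 (1 - 0)) :=
      tendsto_const_nhds.sub
        ((tendsto_atTop_add_const_right _ c hatTop).const_div_atTop (2 * c))
    rw [sub_zero] at h
    refine h.congr' ?_
    filter_upwards [hmem] with γ hγ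
    have hr : c < ρs γ := hgt γ hγ
    have : ρs γ + c ≠ 0 := by linarith
    field_simp
    ring
  have hlim := ((tendsto_const_nhds (x := (um - up) ^ 2 / 4)).div hq one_ne_zero).add
    (tendsto_sub_one_div_two_mul_rpow hc)
  rw [div_one, add_zero] at hlim
  exact tendsto_of_tendsto_of_tendsto_of_le_of_le' tendsto_const_nhds hlim
    (hmem.mono hlower) (hmem.mono hupper)
end

section
/- Let ρ₋, ρ₊ > 0, u₋ > u₊, β ∈ ℝ and t ≥ 0. Suppose ρ* : (1,2) → ℝ is a continuous function such that for every γ ∈ (1,2), ρ*(γ) > max(ρ₋,ρ₊) and u₋ − u₊ = Θ_γ(ρ*(γ),ρ₋)·(ρ*(γ) − ρ₋) + Θ_γ(ρ*(γ),ρ₊)·(ρ*(γ) − ρ₊). Define v*(γ) = u₋ − Θ_γ(ρ*(γ),ρ₋)·(ρ*(γ) − ρ₋) and the 2-shock speed σ₂^γ(t) = v*(γ) + βt + ρ₊·Θ_γ(ρ*(γ),ρ₊). Then σ₂^γ(t) → (u₋ + u₊)/2 + βt as γ → 1⁺. -/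
open Real Filter Topology

theorem Theta_mul_sub_nonneg {a b : ℝ} (γ : ℝ) (hab : b ≤ a) : 0 ≤ Theta γ a b * (a - b) :=
  mul_nonneg (Real.sqrt_nonneg _) (sub_nonneg.2 hab)

theorem Theta_mul_sub_sq {γ a b : ℝ} (hγ : 1 < γ) (hb : 0 < b) (hab : b < a) :
    (Theta γ a b * (a - b)) ^ 2 =
      (γ - 1) / 2 * (a ^ (γ - 1) - b ^ (γ - 1)) * ((a - b) / (a + b)) := by
  have hsub : 0 < a - b := sub_pos.2 hab
  have hadd : 0 < a + b := by linarith
  have hpow : b ^ (γ - 1) < a ^ (γ - 1) := Real.rpow_lt_rpow hb.le hab (sub_pos.2 hγ)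
  have hnum : 0 ≤ (γ - 1) / 2 * (a ^ (γ - 1) - b ^ (γ - 1)) :=
    mul_nonneg (by linarith) (sub_nonneg.2 hpow.le)
  rw [mul_pow, Theta, Real.sq_sqrt (div_nonneg hnum (by positivity))]
  field_simp

theorem Theta_mul_sub_sq_le {γ a b : ℝ} (hγ : γ ∈ Set.Ioo (1 : ℝ) 2) (hb : 0 < b) (hab : b < a) :
    (Theta γ a b * (a - b)) ^ 2 ≤ (γ - 1) / 2 * (1 + a) := by
  have ha : 0 < a := hb.trans hab
  have hε : 0 < γ - 1 := sub_pos.2 hγ.1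
  have hbpow : 0 < b ^ (γ - 1) := Real.rpow_pos_of_pos hb _
  have hapow : a ^ (γ - 1) ≤ 1 + a := calc
    a ^ (γ - 1) ≤ (1 + a) ^ (γ - 1) := Real.rpow_le_rpow ha.le (by linarith) hε.le
    _ ≤ (1 + a) ^ (1 : ℝ) :=
      Real.rpow_le_rpow_of_exponent_le (by linarith) (by linarith [hγ.2])
    _ = 1 + a := Real.rpow_one _
  have hratio : (a - b) / (a + b) ≤ 1 := by
    rw [div_le_one (by linarith)]
    linarith
  have hratio_nonneg : 0 ≤ (a - b) / (a + b) := div_nonneg (by linarith) (by linarith)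
  rw [Theta_mul_sub_sq hγ.1 hb hab, mul_assoc]
  refine mul_le_mul_of_nonneg_left ?_ (by linarith)
  calc (a ^ (γ - 1) - b ^ (γ - 1)) * ((a - b) / (a + b))
      ≤ (1 + a) * ((a - b) / (a + b)) :=
        mul_le_mul_of_nonneg_right (by linarith) hratio_nonneg
    _ ≤ 1 + a := mul_le_of_le_one_right (by linarith) hratio

theorem tendsto_sub_div_add_atTop (b : ℝ) :
    Tendsto (fun a : ℝ => (a - b) / (a + b)) atTop (𝓝 1) := by
  have h : Tendsto (fun a : ℝ => 1 - 2 * b / (a + b)) atTop (𝓝 (1 - 0)) :=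
    tendsto_const_nhds.sub
      (Tendsto.const_div_atTop (tendsto_atTop_add_const_right _ b tendsto_id) _)
  rw [sub_zero] at h
  refine h.congr' ?_
  filter_upwards [eventually_gt_atTop (-b)] with a ha
  have : a + b ≠ 0 := by linarith
  field_simp
  ring

/-- Lemma 4.3: the 2-shock speed σ₂^γ(t) tends to the delta-shock speed
u_δ(t) = (u₋+u₊)/2 + βt as γ → 1⁺. -/
theorem lemma43_sigma2 (ρm ρp um up β t : ℝ) (hρm : 0 < ρm) (hρp : 0 < ρp)
    (hu : up < um) (ht : 0 ≤ t)
    (ρs : ℝ → ℝ) (hcont : ContinuousOn ρs (Set.Ioo (1 : ℝ) 2))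
    (hgt : ∀ γ ∈ Set.Ioo (1 : ℝ) 2, ρs γ > max ρm ρp)
    (heq : ∀ γ ∈ Set.Ioo (1 : ℝ) 2,
      um - up = Theta γ (ρs γ) ρm * (ρs γ - ρm) + Theta γ (ρs γ) ρp * (ρs γ - ρp)) :
    Tendsto
      (fun γ : ℝ =>
        (um - Theta γ (ρs γ) ρm * (ρs γ - ρm)) + β * t + ρp * Theta γ (ρs γ) ρp)
      (𝓝[>] (1 : ℝ)) (𝓝 ((um + up) / 2 + β * t)) := by
  set D := um - up with hD
  have hDpos : 0 < D := sub_pos.2 hu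
  have hmem : ∀ᶠ γ in 𝓝[>] (1 : ℝ), γ ∈ Set.Ioo (1 : ℝ) 2 := Ioo_mem_nhdsGT (by norm_num)
  have hm : ∀ γ ∈ Set.Ioo (1 : ℝ) 2, ρm < ρs γ := fun γ h => (le_max_left _ _).trans_lt (hgt γ h)
  have hp : ∀ γ ∈ Set.Ioo (1 : ℝ) 2, ρp < ρs γ := fun γ h => (le_max_right _ _).trans_lt (hgt γ h)
  have hε : Tendsto (fun γ : ℝ => γ - 1) (𝓝[>] 1) (𝓝 0) := by
    have : Tendsto (fun γ : ℝ => γ - 1) (𝓝 1) (𝓝 (1 - 1)) := tendsto_id.sub tendsto_const_nhds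
    rw [sub_self] at this
    exact this.mono_left nhdsWithin_le_nhds
  have hρ : Tendsto ρs (𝓝[>] 1) atTop := by
    have hinv : Tendsto (fun γ : ℝ => (γ - 1)⁻¹) (𝓝[>] 1) atTop :=
      tendsto_inv_nhdsGT_zero.comp (tendsto_nhdsWithin_iff.2
        ⟨hε, by filter_upwards [hmem] with γ h using sub_pos.2 h.1⟩)
    refine tendsto_atTop_mono' _ ?_
      (tendsto_atTop_add_const_right _ (-1) (hinv.const_mul_atTop (half_pos (pow_pos hDpos 2))))
    filter_upwards [hmem] with γ h
    have h1 := Theta_mul_sub_sq_le h hρm (hm γ h)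
    have h2 := Theta_mul_sub_sq_le h hρp (hp γ h)
    have hpos : 0 < γ - 1 := sub_pos.2 h.1
    have h3 : D ^ 2 / 2 ≤ (1 + ρs γ) * (γ - 1) := by
      rw [heq γ h]
      nlinarith [sq_nonneg (Theta γ (ρs γ) ρm * (ρs γ - ρm) - Theta γ (ρs γ) ρp * (ρs γ - ρp))]
    have h4 := (div_le_iff₀ hpos).2 h3
    rw [div_eq_mul_inv (D ^ 2 / 2)] at h4
    linarith
  have hΘp : Tendsto (fun γ => Theta γ (ρs γ) ρp) (𝓝[>] 1) (𝓝 0) := by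
    have hlim : Tendsto (fun γ => D / (ρs γ - ρp)) (𝓝[>] 1) (𝓝 0) :=
      Tendsto.const_div_atTop (tendsto_atTop_add_const_right _ (-ρp) hρ) D
    refine tendsto_of_tendsto_of_tendsto_of_le_of_le' tendsto_const_nhds hlim
      (Eventually.of_forall fun γ => Real.sqrt_nonneg _) ?_
    filter_upwards [hmem] with γ h
    rw [le_div_iff₀ (sub_pos.2 (hp γ h)), heq γ h]
    linarith [Theta_mul_sub_nonneg γ (hm γ h).le]
  have hratio_p := (tendsto_sub_div_add_atTop ρp).comp hρ
  have hratio : Tendsto (fun γ => 1 - ((ρs γ - ρp) / (ρs γ + ρp)) / ((ρs γ - ρm) / (ρs γ + ρm)))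
      (𝓝[>] 1) (𝓝 0) := by
    have := tendsto_const_nhds (x := (1 : ℝ)).sub
      (hratio_p.div ((tendsto_sub_div_add_atTop ρm).comp hρ) one_ne_zero)
    simpa using this
  have hmain : Tendsto (fun γ => (Theta γ (ρs γ) ρm * (ρs γ - ρm)) ^ 2 *
      (1 - ((ρs γ - ρp) / (ρs γ + ρp)) / ((ρs γ - ρm) / (ρs γ + ρm)))) (𝓝[>] 1) (𝓝 0) := by
    refine squeeze_zero_norm' (a := fun γ => D ^ 2 *
      |1 - ((ρs γ - ρp) / (ρs γ + ρp)) / ((ρs γ - ρm) / (ρs γ + ρm))|) ?_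
      (by simpa using hratio.abs.const_mul (D ^ 2))
    filter_upwards [hmem] with γ h
    rw [Real.norm_eq_abs, abs_mul, abs_of_nonneg (sq_nonneg _)]
    refine mul_le_mul_of_nonneg_right
      (pow_le_pow_left₀ (Theta_mul_sub_nonneg γ (hm γ h).le) ?_ 2) (abs_nonneg _)
    rw [heq γ h]
    linarith [Theta_mul_sub_nonneg γ (hp γ h).le]
  have hpow : ∀ b : ℝ, 0 < b → Tendsto (fun γ : ℝ => b ^ (γ - 1)) (𝓝[>] 1) (𝓝 1) := by
    intro b hb
    simpa using tendsto_const_nhds (x := b).rpow hε (Or.inl hb.ne')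
  have hrest : Tendsto (fun γ => (γ - 1) / 2 * (ρp ^ (γ - 1) - ρm ^ (γ - 1)) *
      ((ρs γ - ρp) / (ρs γ + ρp))) (𝓝[>] 1) (𝓝 0) := by
    simpa using ((hε.div_const 2).mul ((hpow ρp hρp).sub (hpow ρm hρm))).mul hratio_p
  have hX : Tendsto (fun γ => Theta γ (ρs γ) ρm * (ρs γ - ρm)) (𝓝[>] 1) (𝓝 (D / 2)) := by
    have hlim := (((hmain.add hrest).div_const D).const_add D).div_const 2
    rw [add_zero, zero_div, add_zero] at hlim
    refine hlim.congr' ?_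
    filter_upwards [hmem] with γ h
    have hr : (ρs γ - ρm) / (ρs γ + ρm) ≠ 0 :=
      (div_pos (sub_pos.2 (hm γ h)) (by linarith [hm γ h])).ne'
    have hsq : (Theta γ (ρs γ) ρm * (ρs γ - ρm)) ^ 2 *
          (1 - ((ρs γ - ρp) / (ρs γ + ρp)) / ((ρs γ - ρm) / (ρs γ + ρm))) +
        (γ - 1) / 2 * (ρp ^ (γ - 1) - ρm ^ (γ - 1)) * ((ρs γ - ρp) / (ρs γ + ρp)) =
        (Theta γ (ρs γ) ρm * (ρs γ - ρm)) ^ 2 - (Theta γ (ρs γ) ρp * (ρs γ - ρp)) ^ 2 := by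
      rw [Theta_mul_sub_sq h.1 hρp (hp γ h), Theta_mul_sub_sq h.1 hρm (hm γ h)]
      generalize (ρs γ - ρm) / (ρs γ + ρm) = r at hr ⊢
      generalize (ρs γ - ρp) / (ρs γ + ρp) = q
      field_simp
      ring
    have hY : Theta γ (ρs γ) ρp * (ρs γ - ρp) = D - Theta γ (ρs γ) ρm * (ρs γ - ρm) := by
      linarith [heq γ h]
    rw [hsq, hY]
    field_simp
    ring
  have hfinal := ((hX.const_sub um).add_const (β * t)).add (hΘp.const_mul ρp)
  convert hfinal using 2
  rw [hD]
  ring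
end
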